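/- arXiv:2109.09342 — 2 statements merged into one kernel-verified Lean document; each statement's English description precedes it below -/
import Mathlib

section
/- Downward closure: for every formula φ of dependence logic, every τ-structure 𝒜 and all teams P ⊆ T whose domain contains Fr(φ), if (𝒜, T) ⊨ φ then (𝒜, P) ⊨ φ. -/
/-- A relational first-order vocabulary: a type of relation symbols with arities. -/
structure Vocab where
  Rel : Type
  arity : Rel → ℕ

/-- A τ-structure: a universe together with an interpretation of each relation symbol. -/
structure Struc (τ : Vocab) where
  carrier : Type
  rel : ∀ R : τ.Rel, (Fin (τ.arity R) → carrier) → Prop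

/-- Formulas of dependence logic in negation normal form over a relational
vocabulary `τ` with variables from `V` (terms are just variables). -/
inductive DFormula (τ : Vocab) (V : Type) : Type
  | eq : V → V → DFormula τ V
  | rel : (R : τ.Rel) → (Fin (τ.arity R) → V) → DFormula τ V
  | nrel : (R : τ.Rel) → (Fin (τ.arity R) → V) → DFormula τ V
  | dep : (n m : ℕ) → (Fin n → V) → (Fin m → V) → DFormula τ V
  | and : DFormula τ V → DFormula τ V → DFormula τ V
  | or : DFormula τ V → DFormula τ V → DFormula τ V
  | ex : V → DFormula τ V → DFormula τ V
  | all : V → DFormula τ V → DFormula τ V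

variable {τ : Vocab} {V : Type}

/-- Free variables of a dependence-logic formula. -/
def Fr [DecidableEq V] : DFormula τ V → Finset V
  | .eq v w => {v, w}
  | .rel _ ts => Finset.univ.image ts
  | .nrel _ ts => Finset.univ.image ts
  | .dep _ _ ts us => Finset.univ.image ts ∪ Finset.univ.image us
  | .and φ ψ => Fr φ ∪ Fr ψ
  | .or φ ψ => Fr φ ∪ Fr ψ
  | .ex x φ => Fr φ \ {x}
  | .all x φ => Fr φ \ {x}

/-- Team semantics of dependence logic.  An assignment is a partial map
`V → Option 𝒜.carrier` (`none` = outside the domain); a team is a set of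
assignments. -/
def satisfies [DecidableEq V] (𝒜 : Struc τ) :
    Set (V → Option 𝒜.carrier) → DFormula τ V → Prop
  | T, .eq v w => ∀ s ∈ T, s v = s w
  | T, .rel R ts => ∀ s ∈ T, ∃ as : Fin (τ.arity R) → 𝒜.carrier,
      (∀ i, s (ts i) = some (as i)) ∧ 𝒜.rel R as
  | T, .nrel R ts => ∀ s ∈ T, ∃ as : Fin (τ.arity R) → 𝒜.carrier,
      (∀ i, s (ts i) = some (as i)) ∧ ¬ 𝒜.rel R as
  | T, .dep _ _ ts us => ∀ s₁ ∈ T, ∀ s₂ ∈ T,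
      (∀ i, s₁ (ts i) = s₂ (ts i)) → ∀ j, s₁ (us j) = s₂ (us j)
  | T, .and φ ψ => satisfies 𝒜 T φ ∧ satisfies 𝒜 T ψ
  | T, .or φ ψ => ∃ T₀ T₁, T₀ ∪ T₁ = T ∧ satisfies 𝒜 T₀ φ ∧ satisfies 𝒜 T₁ ψ
  | T, .ex x φ => ∃ F : (V → Option 𝒜.carrier) → Set 𝒜.carrier,
      (∀ s ∈ T, (F s).Nonempty) ∧
      satisfies 𝒜 {s' | ∃ s ∈ T, ∃ a ∈ F s, s' = Function.update s x (some a)} φ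
  | T, .all x φ =>
      satisfies 𝒜 {s' | ∃ s ∈ T, ∃ a : 𝒜.carrier, s' = Function.update s x (some a)} φ

/-- Satisfaction is antitone in the team, with no assumption on the domains of the assignments. -/
theorem satisfies_antitone [DecidableEq V] (𝒜 : Struc τ) (φ : DFormula τ V)
    {T P : Set (V → Option 𝒜.carrier)} (hPT : P ⊆ T) (hT : satisfies 𝒜 T φ) :
    satisfies 𝒜 P φ := by
  induction φ generalizing T P with
  | eq v w => exact fun s hs => hT s (hPT hs)
  | rel R ts => exact fun s hs => hT s (hPT hs)
  | nrel R ts => exact fun s hs => hT s (hPT hs)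
  | dep n m ts us => exact fun s₁ h₁ s₂ h₂ => hT s₁ (hPT h₁) s₂ (hPT h₂)
  | and φ ψ ihφ ihψ => exact ⟨ihφ hPT hT.1, ihψ hPT hT.2⟩
  | or φ ψ ihφ ihψ =>
    obtain ⟨T₀, T₁, hU, h₀, h₁⟩ := hT
    refine ⟨T₀ ∩ P, T₁ ∩ P, ?_, ihφ Set.inter_subset_left h₀, ihψ Set.inter_subset_left h₁⟩
    rw [← Set.union_inter_distrib_right, hU, Set.inter_eq_right.mpr hPT]
  | ex x φ ih =>
    obtain ⟨F, hF, h⟩ := hT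
    refine ⟨F, fun s hs => hF s (hPT hs), ih ?_ h⟩
    rintro _ ⟨s, hs, a, ha, rfl⟩
    exact ⟨s, hPT hs, a, ha, rfl⟩
  | all x φ ih =>
    refine ih ?_ hT
    rintro _ ⟨s, hs, a, rfl⟩
    exact ⟨s, hPT hs, a, rfl⟩

/-- **Downward closure**: for every formula `φ` of dependence logic, every
`τ`-structure `𝒜` and all teams `P ⊆ T` whose domain contains `Fr φ`,
if `(𝒜, T) ⊨ φ` then `(𝒜, P) ⊨ φ`. -/
theorem downward_closure [DecidableEq V] (𝒜 : Struc τ) (φ : DFormula τ V)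
    (T P : Set (V → Option 𝒜.carrier)) (hPT : P ⊆ T)
    (hdom : ∀ s ∈ T, ∀ v ∈ Fr φ, (s v).isSome)
    (hT : satisfies 𝒜 T φ) : satisfies 𝒜 P φ :=
  satisfies_antitone 𝒜 φ hPT hT
end

section
/- Correctness of Kontinen's reduction from 3-SAT: let m ≥ 1 and let φ = ⋀_{i=1}^m (ℓ_{i,1} ∨ ℓ_{i,2} ∨ ℓ_{i,3}) be a 3-CNF formula over a set V of propositional variables, where each literal ℓ_{i,j} is encoded as a pair (p_{i,j}, b_{i,j}) ∈ V × {0,1} (b = 1 for a positive occurrence, b = 0 for a negated occurrence). Let T = { (p_{i,j}, b_{i,j}, i, j) : 1 ≤ i ≤ m, j ∈ {1,2,3} } be the corresponding set of quadruples. Then φ is satisfiable — i.e., there is θ : V → {0,1} such that for every i ≤ m there is some j ∈ {1,2,3} with θ(p_{i,j}) = b_{i,j} — if and only if there exist subsets P₀, P₁, P₂ of T with P₀ ∪ P₁ ∪ P₂ = T such that P₀ satisfies dep(x;y) and both P₁ and P₂ satisfy dep(u;v). -/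
/-- The team of Kontinen's reduction: the quadruples `(p_{i,j}, b_{i,j}, i, j)`
for `1 ≤ i ≤ m` and `j ∈ {1,2,3}`, viewed as assignments to the variables
`x, y, u, v` (first coordinate = value of `x`, second = `y`, third = `u`,
fourth = `v`). -/
def kontinenTeam {V : Type} {m : ℕ} (p : Fin m → Fin 3 → V)
    (b : Fin m → Fin 3 → Bool) : Set (V × Bool × Fin m × Fin 3) :=
  Set.range fun ij : Fin m × Fin 3 => (p ij.1 ij.2, b ij.1 ij.2, ij.1, ij.2)

/-- A set of quadruples satisfies the dependence atom `dep(x;y)` iff any two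
of its elements agreeing in the first coordinate agree in the second. -/
def satDepXY {V : Type} {m : ℕ} (P : Set (V × Bool × Fin m × Fin 3)) : Prop :=
  ∀ q₁ ∈ P, ∀ q₂ ∈ P, q₁.1 = q₂.1 → q₁.2.1 = q₂.2.1

/-- A set of quadruples satisfies the dependence atom `dep(u;v)` iff any two
of its elements agreeing in the third coordinate agree in the fourth. -/
def satDepUV {V : Type} {m : ℕ} (P : Set (V × Bool × Fin m × Fin 3)) : Prop :=
  ∀ q₁ ∈ P, ∀ q₂ ∈ P, q₁.2.2.1 = q₂.2.2.1 → q₁.2.2.2 = q₂.2.2.2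

/-- The quadruple `(p_{i,j}, b_{i,j}, i, j)` selected in each clause `i` by `j = f i`. -/
def clauseSelection {V : Type} {m : ℕ} (p : Fin m → Fin 3 → V) (b : Fin m → Fin 3 → Bool)
    (f : Fin m → Fin 3) : Set (V × Bool × Fin m × Fin 3) :=
  Set.range fun i => (p i (f i), b i (f i), i, f i)

theorem clauseSelection_subset {V : Type} {m : ℕ} (p : Fin m → Fin 3 → V)
    (b : Fin m → Fin 3 → Bool) (f : Fin m → Fin 3) :
    clauseSelection p b f ⊆ kontinenTeam p b := by
  rintro _ ⟨i, rfl⟩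
  exact ⟨(i, f i), rfl⟩

theorem satDepUV_clauseSelection {V : Type} {m : ℕ} (p : Fin m → Fin 3 → V)
    (b : Fin m → Fin 3 → Bool) (f : Fin m → Fin 3) :
    satDepUV (clauseSelection p b f) := by
  rintro _ ⟨i, rfl⟩ _ ⟨k, rfl⟩ h
  exact congrArg f h

/-- A set satisfying `dep(x;y)` is contained in the graph of a valuation. -/
theorem satDepXY.exists_valuation {V : Type} {m : ℕ} {P : Set (V × Bool × Fin m × Fin 3)}
    (h : satDepXY P) : ∃ θ : V → Bool, ∀ q ∈ P, θ q.1 = q.2.1 := by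
  classical
  refine ⟨fun x => decide (∃ q ∈ P, q.1 = x ∧ q.2.1 = true), fun q hq => ?_⟩
  rw [Bool.eq_iff_iff, decide_eq_true_iff]
  constructor
  · rintro ⟨r, hr, hrq, hr'⟩
    rw [← h r hr q hq hrq, hr']
  · exact fun hq' => ⟨q, hq, rfl, hq'⟩

/-- Two sets satisfying `dep(u;v)` cannot cover all three literals of a clause. -/
theorem exists_notMem_of_satDepUV {V : Type} {m : ℕ} (p : Fin m → Fin 3 → V)
    (b : Fin m → Fin 3 → Bool) {P₁ P₂ : Set (V × Bool × Fin m × Fin 3)}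
    (h₁ : satDepUV P₁) (h₂ : satDepUV P₂) (i : Fin m) :
    ∃ j, (p i j, b i j, i, j) ∉ P₁ ∪ P₂ := by
  by_contra! h
  have eq₁ : ∀ j k, (p i j, b i j, i, j) ∈ P₁ → (p i k, b i k, i, k) ∈ P₁ → j = k :=
    fun j k hj hk => h₁ _ hj _ hk rfl
  have eq₂ : ∀ j k, (p i j, b i j, i, j) ∈ P₂ → (p i k, b i k, i, k) ∈ P₂ → j = k :=
    fun j k hj hk => h₂ _ hj _ hk rfl
  have h01 : (0 : Fin 3) ≠ 1 := by decide
  have h02 : (0 : Fin 3) ≠ 2 := by decide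
  have h12 : (1 : Fin 3) ≠ 2 := by decide
  rcases h 0 with c0 | c0 <;> rcases h 1 with c1 | c1 <;> rcases h 2 with c2 | c2 <;>
    first
    | exact h01 (eq₁ _ _ c0 c1)
    | exact h01 (eq₂ _ _ c0 c1)
    | exact h02 (eq₁ _ _ c0 c2)
    | exact h02 (eq₂ _ _ c0 c2)
    | exact h12 (eq₁ _ _ c1 c2)
    | exact h12 (eq₂ _ _ c1 c2)

/-- **Correctness of Kontinen's reduction from 3-SAT**: a 3-CNF formula with
clauses `(ℓ_{i,1} ∨ ℓ_{i,2} ∨ ℓ_{i,3})`, `1 ≤ i ≤ m`, whose literals are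
encoded as pairs `(p_{i,j}, b_{i,j}) ∈ V × {0,1}`, is satisfiable iff the
team `T = {(p_{i,j}, b_{i,j}, i, j)}` can be covered as `P₀ ∪ P₁ ∪ P₂ = T`
by subsets `P₀, P₁, P₂ ⊆ T` such that `P₀ ⊨ dep(x;y)` and
`P₁ ⊨ dep(u;v)` and `P₂ ⊨ dep(u;v)`. -/
theorem kontinen_reduction_correct {V : Type} (m : ℕ) (hm : 1 ≤ m)
    (p : Fin m → Fin 3 → V) (b : Fin m → Fin 3 → Bool) :
    (∃ θ : V → Bool, ∀ i : Fin m, ∃ j : Fin 3, θ (p i j) = b i j) ↔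
      ∃ P₀ P₁ P₂ : Set (V × Bool × Fin m × Fin 3),
        P₀ ⊆ kontinenTeam p b ∧ P₁ ⊆ kontinenTeam p b ∧ P₂ ⊆ kontinenTeam p b ∧
        P₀ ∪ P₁ ∪ P₂ = kontinenTeam p b ∧
        satDepXY P₀ ∧ satDepUV P₁ ∧ satDepUV P₂ := by
  constructor
  · rintro ⟨θ, hθ⟩
    choose f hf using hθ
    refine ⟨clauseSelection p b f, clauseSelection p b fun i => f i + 1,
      clauseSelection p b fun i => f i + 2, clauseSelection_subset _ _ _,
      clauseSelection_subset _ _ _, clauseSelection_subset _ _ _, ?_, ?_,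
      satDepUV_clauseSelection _ _ _, satDepUV_clauseSelection _ _ _⟩
    · refine Set.Subset.antisymm (Set.union_subset (Set.union_subset
        (clauseSelection_subset _ _ _) (clauseSelection_subset _ _ _))
        (clauseSelection_subset _ _ _)) ?_
      rintro _ ⟨⟨i, j⟩, rfl⟩
      have hj : ∀ a j : Fin 3, (a = j ∨ a + 1 = j) ∨ a + 2 = j := by decide
      rcases hj (f i) j with (rfl | rfl) | rfl
      · exact Or.inl (Or.inl ⟨i, rfl⟩)
      · exact Or.inl (Or.inr ⟨i, rfl⟩)
      · exact Or.inr ⟨i, rfl⟩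
    · rintro _ ⟨i, rfl⟩ _ ⟨k, rfl⟩ h
      exact (hf i).symm.trans ((congrArg θ h).trans (hf k))
  · rintro ⟨P₀, P₁, P₂, -, -, -, hT, h₀, h₁, h₂⟩
    obtain ⟨θ, hθ⟩ := h₀.exists_valuation
    refine ⟨θ, fun i => ?_⟩
    obtain ⟨j, hj⟩ := exists_notMem_of_satDepUV p b h₁ h₂ i
    have hmem : (p i j, b i j, i, j) ∈ P₀ ∪ P₁ ∪ P₂ := hT ▸ ⟨(i, j), rfl⟩
    rw [Set.union_assoc] at hmem
    exact ⟨j, hθ _ (hmem.resolve_right hj)⟩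
end
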